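/- arXiv:math/0502546 — 4 statements merged into one kernel-verified Lean document; each statement's English description precedes it below -/
import Mathlib

section
/- Let a, b, r₁, r₂, r₃, r₄ ∈ ℂ with a ≠ 0 and b ≠ 0, and let z₁(t) = a(t−r₁)(t−r₂) and z₂(t) = b(t−r₃)(t−r₄) be complex polynomials. Then there exists a complex polynomial z with z₁'·z₂ − z₁·z₂' = z² if and only if (r₁−r₃)(r₂−r₃)(r₁−r₄)(r₂−r₄) = 0, i.e., if and only if z₁ and z₂ have a common root. -/
open Polynomial

/-- Over an algebraically closed field of characteristic not two, a polynomial of degree at most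
two is a square iff its discriminant vanishes. -/
theorem exists_quadratic_eq_sq_iff {K : Type*} [Field K] [IsAlgClosed K] [NeZero (2 : K)]
    (a b c : K) :
    (∃ z : K[X], C a * X ^ 2 + C b * X + C c = z ^ 2) ↔ discrim a b c = 0 := by
  have sq_linear (u v : K) : (C u * X + C v) ^ 2 =
      C (u ^ 2) * X ^ 2 + C (2 * u * v) * X + C (v ^ 2) := by
    simp only [C_mul, C_pow, map_ofNat]
    ring
  constructor
  · rintro ⟨z, hz⟩
    have hdeg : z.natDegree ≤ 1 := by
      have h := natDegree_quadratic_le (a := a) (b := b) (c := c)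
      rw [hz, natDegree_pow] at h
      omega
    obtain ⟨u, v, rfl⟩ := exists_eq_X_add_C_of_natDegree_le_one hdeg
    rw [sq_linear] at hz
    have h0 := congrArg (coeff · 0) hz
    have h1 := congrArg (coeff · 1) hz
    have h2 := congrArg (coeff · 2) hz
    simp [coeff_X, coeff_C, coeff_X_pow, -map_mul, -map_pow] at h0 h1 h2
    rw [discrim, h0, h1, h2]
    ring
  · intro h
    rw [discrim] at h
    obtain rfl | ha := eq_or_ne a 0
    · obtain ⟨v, rfl⟩ := IsAlgClosed.exists_pow_nat_eq c two_pos
      obtain rfl : b = 0 := by simpa using h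
      exact ⟨C v, by simp⟩
    · obtain ⟨u, rfl⟩ := IsAlgClosed.exists_pow_nat_eq a two_pos
      have hu : u ≠ 0 := by rintro rfl; simp at ha
      have h2 : (2 : K) ≠ 0 := NeZero.ne 2
      refine ⟨C u * X + C (b / (2 * u)), ?_⟩
      rw [sq_linear]
      congr 3
      · field_simp
      · field_simp
        linear_combination -h

/-- For quadratics `z₁ = a(t-r₁)(t-r₂)` and `z₂ = b(t-r₃)(t-r₄)` with `a, b ≠ 0`,
the Wronskian `z₁'z₂ - z₁z₂'` is a perfect square of a complex polynomial iff
`(r₁-r₃)(r₂-r₃)(r₁-r₄)(r₂-r₄) = 0`, i.e. iff `z₁` and `z₂` share a root. -/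
theorem wronskian_square_iff_common_root_quadratic (a b r₁ r₂ r₃ r₄ : ℂ)
    (ha : a ≠ 0) (hb : b ≠ 0) :
    (∃ z : ℂ[X],
      derivative (C a * (X - C r₁) * (X - C r₂)) * (C b * (X - C r₃) * (X - C r₄)) -
        C a * (X - C r₁) * (X - C r₂) * derivative (C b * (X - C r₃) * (X - C r₄)) =
      z ^ 2) ↔
    (r₁ - r₃) * (r₂ - r₃) * (r₁ - r₄) * (r₂ - r₄) = 0 := by
  have key :
      derivative (C a * (X - C r₁) * (X - C r₂)) * (C b * (X - C r₃) * (X - C r₄)) -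
        C a * (X - C r₁) * (X - C r₂) * derivative (C b * (X - C r₃) * (X - C r₄)) =
      C (a * b * (r₁ + r₂ - r₃ - r₄)) * X ^ 2 + C (2 * a * b * (r₃ * r₄ - r₁ * r₂)) * X +
        C (a * b * (r₁ * r₂ * (r₃ + r₄) - r₃ * r₄ * (r₁ + r₂))) := by
    simp only [derivative_mul, derivative_sub, derivative_C, derivative_X, C_mul, C_sub, C_add,
      map_ofNat]
    ring
  have hdiscrim : discrim (a * b * (r₁ + r₂ - r₃ - r₄)) (2 * a * b * (r₃ * r₄ - r₁ * r₂))
      (a * b * (r₁ * r₂ * (r₃ + r₄) - r₃ * r₄ * (r₁ + r₂))) =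
      4 * (a * b) ^ 2 * ((r₁ - r₃) * (r₂ - r₃) * (r₁ - r₄) * (r₂ - r₄)) := by
    rw [discrim]
    ring
  rw [key, exists_quadratic_eq_sq_iff, hdiscrim]
  exact mul_eq_zero_iff_left (by simp [ha, hb])
end

section
/- Let a, b, r₁, r₂, r₃, r₄, m, n ∈ ℂ with ab ≠ 0. If m² = ab(r₁+r₂−r₃−r₄), mn = ab(r₃r₄−r₁r₂), and n² = ab((r₃+r₄)r₁r₂ − (r₁+r₂)r₃r₄), then (r₁−r₃)(r₂−r₃)(r₁−r₄)(r₂−r₄) = 0. -/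
/-- If `m² = ab(r₁+r₂-r₃-r₄)`, `mn = ab(r₃r₄-r₁r₂)` and
`n² = ab((r₃+r₄)r₁r₂ - (r₁+r₂)r₃r₄)` with `ab ≠ 0`, then
`(r₁-r₃)(r₂-r₃)(r₁-r₄)(r₂-r₄) = 0`. -/
theorem monotone_helix_algebraic_identity (a b r₁ r₂ r₃ r₄ m n : ℂ) (hab : a * b ≠ 0)
    (h1 : m ^ 2 = a * b * (r₁ + r₂ - r₃ - r₄))
    (h2 : m * n = a * b * (r₃ * r₄ - r₁ * r₂))
    (h3 : n ^ 2 = a * b * ((r₃ + r₄) * (r₁ * r₂) - (r₁ + r₂) * (r₃ * r₄))) :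
    (r₁ - r₃) * (r₂ - r₃) * (r₁ - r₄) * (r₂ - r₄) = 0 := by
  refine (mul_eq_zero.mp ?_).resolve_left (pow_ne_zero 2 hab)
  linear_combination n ^ 2 * h1 - (m * n + a * b * (r₃ * r₄ - r₁ * r₂)) * h2 +
    a * b * (r₁ + r₂ - r₃ - r₄) * h3
end

section
/- Let a, b, r₁, r₂, r₃ ∈ ℂ with a ≠ 0 and b ≠ 0, and let z₁(t) = a(t−r₁)(t−r₂) and z₂(t) = b(t−r₃) be complex polynomials. Then there exists a complex polynomial z with z₁'·z₂ − z₁·z₂' = z² if and only if r₃ = r₁ or r₃ = r₂, i.e., if and only if z₁ and z₂ have a common root. -/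
open Polynomial

/-- The Wronskian of `a(t-r₁)(t-r₂)` and `b(t-r₃)`, with the square in `t - r₃` completed. -/
theorem wronskian_quadratic_linear {R : Type*} [CommRing R] (a b r₁ r₂ r₃ : R) :
    derivative (C a * (X - C r₁) * (X - C r₂)) * (C b * (X - C r₃)) -
        C a * (X - C r₁) * (X - C r₂) * derivative (C b * (X - C r₃)) =
      C (a * b) * ((X - C r₃) ^ 2 - C ((r₃ - r₁) * (r₃ - r₂))) := by
  simp only [derivative_mul, derivative_sub, derivative_X, derivative_C, C_mul, C_sub]
  ring

/-- For `z₁ = a(t-r₁)(t-r₂)` quadratic and `z₂ = b(t-r₃)` linear with `a, b ≠ 0`,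
the Wronskian `z₁'z₂ - z₁z₂'` is a perfect square of a complex polynomial iff
`r₃ = r₁` or `r₃ = r₂`, i.e. iff `z₁` and `z₂` share a root. -/
theorem wronskian_square_iff_common_root_linear (a b r₁ r₂ r₃ : ℂ)
    (ha : a ≠ 0) (hb : b ≠ 0) :
    (∃ z : ℂ[X],
      derivative (C a * (X - C r₁) * (X - C r₂)) * (C b * (X - C r₃)) -
        C a * (X - C r₁) * (X - C r₂) * derivative (C b * (X - C r₃)) =
      z ^ 2) ↔
    (r₃ = r₁ ∨ r₃ = r₂) := by
  rw [wronskian_quadratic_linear, ← sub_eq_zero (a := r₃) (b := r₁),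
    ← sub_eq_zero (a := r₃) (b := r₂), ← mul_eq_zero]
  constructor
  · rintro ⟨z, hz⟩
    obtain ⟨s, hs⟩ := IsAlgClosed.exists_pow_nat_eq ((r₃ - r₁) * (r₃ - r₂)) two_pos
    have hroot : z.eval (r₃ + s) = 0 := by
      have h := congrArg (eval (r₃ + s)) hz
      simp only [← hs, eval_mul, eval_sub, eval_pow, eval_X, eval_C, add_sub_cancel_left,
        sub_self, mul_zero] at h
      exact eq_zero_of_pow_eq_zero h.symm
    have hderiv := congrArg (fun p => eval (r₃ + s) (derivative p)) hz
    simp [derivative_pow, hroot, ha, hb] at hderiv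
    rw [← hs, hderiv, zero_pow two_ne_zero]
  · intro h
    obtain ⟨c, hc⟩ := IsAlgClosed.exists_pow_nat_eq (a * b) two_pos
    exact ⟨C c * (X - C r₃), by rw [h, C_0, sub_zero, mul_pow, ← C_pow, hc]⟩
end

section
/- Let u, v, p, q be real polynomials, x' = u²+v²−p²−q², y' = 2(uq+vp), z' = 2(vq−up), and z₁ = u+iv, z₂ = q+ip the associated complex polynomials. Let g = gcd(z₁, z₂) in ℂ[t] and let ḡ be the polynomial obtained from g by conjugating its coefficients. Then the real polynomial g·ḡ is, up to multiplication by a nonzero real constant, the greatest common divisor of x', y', z' in ℝ[t], i.e., gcd(x', y', z') is associated to |gcd(z₁, z₂)|². In particular, gcd(x', y', z') is constant if and only if gcd(z₁, z₂) is constant. -/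
open Polynomial

/-- The complex polynomial `u + i v` associated to real polynomials `u`, `v`. -/
noncomputable def cplxPoly (u v : ℝ[X]) : ℂ[X] :=
  u.map (algebraMap ℝ ℂ) + Polynomial.C Complex.I * v.map (algebraMap ℝ ℂ)

/-- Coefficient-wise conjugation of a complex polynomial is an involution. -/
theorem map_conj_map_conj (f : ℂ[X]) :
    (f.map (starRingEnd ℂ)).map (starRingEnd ℂ) = f := by
  ext n; simp

theorem map_conj_map_ofReal (f : ℝ[X]) :
    (f.map (algebraMap ℝ ℂ)).map (starRingEnd ℂ) = f.map (algebraMap ℝ ℂ) := by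
  ext n; simp

theorem C_I_sq : (C Complex.I : ℂ[X]) ^ 2 = -1 := by
  rw [← C_pow, Complex.I_sq, C_neg, C_1]

theorem map_conj_cplxPoly (u v : ℝ[X]) :
    (cplxPoly u v).map (starRingEnd ℂ) =
      u.map (algebraMap ℝ ℂ) - C Complex.I * v.map (algebraMap ℝ ℂ) := by
  simp [cplxPoly, map_conj_map_ofReal, sub_eq_add_neg, -Complex.coe_algebraMap]

/-- If `s * a + t * b = 1` and `s' * a' + t' * b' = 1`, then `a * a' - b * b'`, `a * b'` and
`a' * b` generate the unit ideal, so a common divisor of their multiples by `k` divides `k`. -/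
theorem dvd_of_dvd_mul_of_bezout {R : Type*} [CommRing R] {a b a' b' s t s' t' k d : R}
    (h : s * a + t * b = 1) (h' : s' * a' + t' * b' = 1)
    (hx : d ∣ k * (a * a' - b * b')) (hy : d ∣ k * (a * b')) (hz : d ∣ k * (a' * b)) :
    d ∣ k := by
  obtain ⟨x, hx⟩ := hx
  obtain ⟨y, hy⟩ := hy
  obtain ⟨z, hz⟩ := hz
  have key : ∀ m : R, d ∣ k * m * (a * a') → d ∣ k * m := by
    rintro m ⟨w, hw⟩
    refine ⟨(s * s' + t * t') * w + m * (s * t' * y + t * s' * z - t * t' * x), ?_⟩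
    linear_combination (-(k * m)) * (s' * a' + t' * b') * h - k * m * h' +
      (s * s' + t * t') * hw + m * s * t' * hy + m * t * s' * hz - m * t * t' * hx
  have hsq : d ∣ k * (a * a') * (a * a') :=
    ⟨a * a' * x + a' * b * y, by linear_combination a * a' * hx + a' * b * hy⟩
  simpa using key 1 (by simpa using key (a * a') hsq)

/-- A common divisor of `|z|² - |w|²`, `z * w̄` and `z̄ * w` divides `|gcd(z, w)|²`. -/
theorem dvd_gcd_mul_map_conj {z w d : ℂ[X]}
    (hx : d ∣ z * z.map (starRingEnd ℂ) - w * w.map (starRingEnd ℂ))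
    (hy : d ∣ z * w.map (starRingEnd ℂ)) (hz : d ∣ z.map (starRingEnd ℂ) * w) :
    d ∣ EuclideanDomain.gcd z w * (EuclideanDomain.gcd z w).map (starRingEnd ℂ) := by
  have hbez := EuclideanDomain.gcd_eq_gcd_ab z w
  obtain ⟨a, ha⟩ := EuclideanDomain.gcd_dvd_left z w
  obtain ⟨b, hb⟩ := EuclideanDomain.gcd_dvd_right z w
  generalize EuclideanDomain.gcdA z w = s at hbez
  generalize EuclideanDomain.gcdB z w = t at hbez
  generalize EuclideanDomain.gcd z w = g at *
  subst ha hb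
  rcases eq_or_ne g 0 with rfl | hg
  · simp
  have hst : s * a + t * b = 1 :=
    mul_left_cancel₀ hg (by linear_combination -hbez)
  have hst' := congrArg (Polynomial.map (starRingEnd ℂ)) hst
  simp only [Polynomial.map_add, Polynomial.map_mul, Polynomial.map_one] at hst' hx hy hz
  refine dvd_of_dvd_mul_of_bezout hst hst' ?_ ?_ ?_
  · convert hx using 1; ring
  · convert hy using 1; ring
  · convert hz using 1; ring

/-- Conjugation-invariant associated complex polynomials differ by a nonzero real constant. -/
theorem exists_real_of_associated {f : ℂ[X]} {r : ℝ[X]}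
    (hf : f.map (starRingEnd ℂ) = f) (h : Associated (r.map (algebraMap ℝ ℂ)) f) :
    ∃ c : ℝ, c ≠ 0 ∧ f = C (c : ℂ) * r.map (algebraMap ℝ ℂ) := by
  rcases eq_or_ne r 0 with rfl | hr
  · refine ⟨1, one_ne_zero, ?_⟩
    simpa using h.symm
  obtain ⟨e, he⟩ := h
  obtain ⟨c, hc, hce⟩ := Polynomial.isUnit_iff.1 e.isUnit
  rw [← hce] at he
  have hr' : r.map (algebraMap ℝ ℂ) ≠ 0 :=
    (Polynomial.map_ne_zero_iff (algebraMap ℝ ℂ).injective).2 hr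
  have hconj : starRingEnd ℂ c = c := by
    rw [← he, Polynomial.map_mul, map_conj_map_ofReal, Polynomial.map_C] at hf
    exact C_injective (mul_left_cancel₀ hr' hf)
  obtain ⟨x, rfl⟩ := Complex.conj_eq_iff_real.1 hconj
  refine ⟨x, ?_, by rw [← he, mul_comm]⟩
  rintro rfl
  simp at hc

theorem natDegree_mul_map_conj (g : ℂ[X]) :
    (g * g.map (starRingEnd ℂ)).natDegree = 2 * g.natDegree := by
  rcases eq_or_ne g 0 with rfl | hg
  · simp
  rw [natDegree_mul hg
    ((Polynomial.map_ne_zero_iff (starRingEnd ℂ).injective).2 hg), natDegree_map, two_mul]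

/-- The hodograph gcd, viewed over `ℂ`, is associated to `|gcd(z₁, z₂)|²`. -/
theorem associated_map_gcd_hodograph (u v p q : ℝ[X]) :
    Associated
      ((EuclideanDomain.gcd (u ^ 2 + v ^ 2 - p ^ 2 - q ^ 2)
        (EuclideanDomain.gcd (2 * (u * q + v * p)) (2 * (v * q - u * p)))).map (algebraMap ℝ ℂ))
      (EuclideanDomain.gcd (cplxPoly u v) (cplxPoly q p) *
        (EuclideanDomain.gcd (cplxPoly u v) (cplxPoly q p)).map (starRingEnd ℂ)) := by
  have hI := C_I_sq
  have hzc := map_conj_cplxPoly u v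
  have hwc := map_conj_cplxPoly q p
  have hx : (u ^ 2 + v ^ 2 - p ^ 2 - q ^ 2).map (algebraMap ℝ ℂ) =
      cplxPoly u v * (cplxPoly u v).map (starRingEnd ℂ) -
        cplxPoly q p * (cplxPoly q p).map (starRingEnd ℂ) := by
    rw [hzc, hwc]
    simp only [cplxPoly, Polynomial.map_sub, Polynomial.map_add, Polynomial.map_pow]
    linear_combination
      ((v.map (algebraMap ℝ ℂ)) ^ 2 - (p.map (algebraMap ℝ ℂ)) ^ 2) * hI
  have hy : (2 * (u * q + v * p)).map (algebraMap ℝ ℂ) =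
      cplxPoly u v * (cplxPoly q p).map (starRingEnd ℂ) +
        (cplxPoly u v).map (starRingEnd ℂ) * cplxPoly q p := by
    rw [hzc, hwc]
    simp only [cplxPoly, Polynomial.map_add, Polynomial.map_mul,
      Polynomial.map_ofNat]
    linear_combination 2 * v.map (algebraMap ℝ ℂ) * p.map (algebraMap ℝ ℂ) * hI
  have hz : (2 * (v * q - u * p)).map (algebraMap ℝ ℂ) =
      C Complex.I * ((cplxPoly u v).map (starRingEnd ℂ) * cplxPoly q p -
        cplxPoly u v * (cplxPoly q p).map (starRingEnd ℂ)) := by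
    rw [hzc, hwc]
    simp only [cplxPoly, Polynomial.map_sub, Polynomial.map_mul, Polynomial.map_ofNat]
    linear_combination 2 * (v.map (algebraMap ℝ ℂ) * q.map (algebraMap ℝ ℂ) -
      u.map (algebraMap ℝ ℂ) * p.map (algebraMap ℝ ℂ)) * hI
  rw [← Polynomial.gcd_map, ← Polynomial.gcd_map, hx, hy, hz]
  generalize cplxPoly u v = z
  generalize cplxPoly q p = w
  have hgz := EuclideanDomain.gcd_dvd_left z w
  have hgw := EuclideanDomain.gcd_dvd_right z w
  have hgz' := Polynomial.map_dvd (starRingEnd ℂ) hgz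
  have hgw' := Polynomial.map_dvd (starRingEnd ℂ) hgw
  have hzw' := mul_dvd_mul hgz hgw'
  have hz'w := mul_comm w (z.map (starRingEnd ℂ)) ▸ mul_dvd_mul hgw hgz'
  apply associated_of_dvd_dvd
  · have hd := EuclideanDomain.gcd_dvd_right
      (z * z.map (starRingEnd ℂ) - w * w.map (starRingEnd ℂ))
      (EuclideanDomain.gcd (z * w.map (starRingEnd ℂ) + z.map (starRingEnd ℂ) * w)
        (C Complex.I * (z.map (starRingEnd ℂ) * w - z * w.map (starRingEnd ℂ))))
    obtain ⟨m, hm⟩ := hd.trans (EuclideanDomain.gcd_dvd_left _ _)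
    obtain ⟨n, hn⟩ := hd.trans (EuclideanDomain.gcd_dvd_right _ _)
    have hhalf : (C (1 / 2 : ℂ)) * 2 = 1 := by
      rw [← C_ofNat, ← C_mul]; norm_num
    refine dvd_gcd_mul_map_conj (EuclideanDomain.gcd_dvd_left _ _)
      ⟨C (1 / 2) * (m + C Complex.I * n), ?_⟩ ⟨C (1 / 2) * (m - C Complex.I * n), ?_⟩
    · linear_combination (-(z * w.map (starRingEnd ℂ))) * hhalf +
        C (1 / 2) * (hm + C Complex.I * hn) -
        C (1 / 2) * (z.map (starRingEnd ℂ) * w - z * w.map (starRingEnd ℂ)) * hI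
    · linear_combination (-(z.map (starRingEnd ℂ) * w)) * hhalf +
        C (1 / 2) * (hm - C Complex.I * hn) +
        C (1 / 2) * (z.map (starRingEnd ℂ) * w - z * w.map (starRingEnd ℂ)) * hI
  · exact EuclideanDomain.dvd_gcd (dvd_sub (mul_dvd_mul hgz hgz') (mul_dvd_mul hgw hgw'))
      (EuclideanDomain.dvd_gcd (dvd_add hzw' hz'w) ((dvd_sub hz'w hzw').mul_left _))

/-- With `x' = u²+v²-p²-q²`, `y' = 2(uq+vp)`, `z' = 2(vq-up)`, `z₁ = u+iv`, `z₂ = q+ip`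
and `g = gcd(z₁, z₂)`, the polynomial `g·ḡ = |gcd(z₁,z₂)|²` equals `gcd(x', y', z')`
up to a nonzero real constant; in particular `gcd(x', y', z')` is constant iff
`gcd(z₁, z₂)` is constant. -/
theorem gcd_hodograph_eq_norm_sq_gcd (u v p q : ℝ[X]) :
    (∃ c : ℝ, c ≠ 0 ∧
      EuclideanDomain.gcd (cplxPoly u v) (cplxPoly q p) *
          (EuclideanDomain.gcd (cplxPoly u v) (cplxPoly q p)).map (starRingEnd ℂ) =
        Polynomial.C (c : ℂ) *
          (EuclideanDomain.gcd (u ^ 2 + v ^ 2 - p ^ 2 - q ^ 2)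
            (EuclideanDomain.gcd (2 * (u * q + v * p)) (2 * (v * q - u * p)))).map
              (algebraMap ℝ ℂ)) ∧
    ((EuclideanDomain.gcd (u ^ 2 + v ^ 2 - p ^ 2 - q ^ 2)
        (EuclideanDomain.gcd (2 * (u * q + v * p)) (2 * (v * q - u * p)))).natDegree = 0 ↔
      (EuclideanDomain.gcd (cplxPoly u v) (cplxPoly q p)).natDegree = 0) := by
  have h := associated_map_gcd_hodograph u v p q
  refine ⟨exists_real_of_associated ?_ h, ?_⟩
  · rw [Polynomial.map_mul, map_conj_map_conj, mul_comm]
  · have hdeg := natDegree_eq_of_degree_eq (degree_eq_degree_of_associated h)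
    rw [natDegree_map, natDegree_mul_map_conj] at hdeg
    omega
end
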